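/- arXiv:1005.5238 — 3 statements merged into one kernel-verified Lean document; each statement's English description precedes it below -/
import Mathlib

section
/- Finite-order intersection of the space and time resonant sets: Let c > 0 and fix k,ℓ,m ∈ {1,c} and ε₀,ε₁,ε₂ ∈ {+1,−1}, with associated sets T, S, R ⊂ ℝ³×ℝ³ = ℝ⁶. Then there exist an integer n ≥ 1 and constants C > 0, ε₁ > 0 such that for all 0 < ε < ε₁, dist( {x ∈ ℝ⁶ : dist(x,R) = ε} ∩ S , {x ∈ ℝ⁶ : dist(x,R) = ε} ∩ T ) ≥ C ε^n, where the distance between two subsets of ℝ⁶ is the infimum of Euclidean distances between their points (interpreted as +∞ if either set is empty). -/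
open MeasureTheory Filter
open scoped ENNReal

noncomputable section

abbrev R3 := EuclideanSpace ℝ (Fin 3)

/-- The phase `φ(ξ,η) = ε₀⟨ξ⟩_k − ε₁⟨η⟩_ℓ − ε₂⟨ξ−η⟩_m`, where `⟨ξ⟩_k = √(1+k²|ξ|²)`. -/
def phase (k l m e0 e1 e2 : ℝ) (ξ η : R3) : ℝ :=
  e0 * Real.sqrt (1 + k ^ 2 * ‖ξ‖ ^ 2) - e1 * Real.sqrt (1 + l ^ 2 * ‖η‖ ^ 2)
    - e2 * Real.sqrt (1 + m ^ 2 * ‖ξ - η‖ ^ 2)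

/-- The time-resonant set `T = {φ = 0}`. -/
def TimeRes (k l m e0 e1 e2 : ℝ) : Set (R3 × R3) :=
  {p | phase k l m e0 e1 e2 p.1 p.2 = 0}

/-- The space-resonant set `S = {∇_η φ = 0}`. -/
def SpaceRes (k l m e0 e1 e2 : ℝ) : Set (R3 × R3) :=
  {p | gradient (fun η => phase k l m e0 e1 e2 p.1 η) p.2 = 0}

/-- The space-time resonant set `R = S ∩ T`. -/
def SpaceTimeRes (k l m e0 e1 e2 : ℝ) : Set (R3 × R3) :=
  SpaceRes k l m e0 e1 e2 ∩ TimeRes k l m e0 e1 e2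

/-- The Euclidean distance on ℝ⁶ = ℝ³ × ℝ³. -/
def d6 (p q : R3 × R3) : ℝ :=
  Real.sqrt (‖p.1 - q.1‖ ^ 2 + ‖p.2 - q.2‖ ^ 2)

/-- Euclidean distance (in ℝ≥0∞, with `⊤` for the empty set) from a point to a set. -/
def edistToSet (x : R3 × R3) (A : Set (R3 × R3)) : ℝ≥0∞ :=
  ⨅ (y : R3 × R3) (_ : y ∈ A), ENNReal.ofReal (d6 x y)

/-- Euclidean distance (in ℝ≥0∞, with `⊤` if either set is empty) between two sets. -/
def edistSets (A B : Set (R3 × R3)) : ℝ≥0∞ :=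
  ⨅ (x : R3 × R3) (_ : x ∈ A) (y : R3 × R3) (_ : y ∈ B), ENNReal.ofReal (d6 x y)

/-- The bracket. -/
def br (a x : ℝ) : ℝ := Real.sqrt (1 + a ^ 2 * x ^ 2)

lemma br_pos (a x : ℝ) : 0 < br a x := Real.sqrt_pos.2 (by positivity)

lemma br_sq (a x : ℝ) : br a x ^ 2 = 1 + a ^ 2 * x ^ 2 := Real.sq_sqrt (by positivity)

lemma br_ge_one (a x : ℝ) : 1 ≤ br a x := by
  rw [br, Real.one_le_sqrt]; nlinarith [mul_nonneg (sq_nonneg a) (sq_nonneg x)]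

lemma br_lower (a x : ℝ) : a * x ≤ br a x := by
  apply Real.le_sqrt_of_sq_le; nlinarith

lemma br_upper (a x : ℝ) (h : 0 ≤ a * x) : br a x ≤ 1 + a * x := by
  rw [br, Real.sqrt_le_left (by linarith)]; nlinarith

lemma hyp_lip (a κ x y p q : ℝ) (ha : 0 ≤ a) (hκ : 0 ≤ κ) (hp : 0 < p) (hq : 0 < q)
    (hp2 : p ^ 2 = a + κ ^ 2 * x ^ 2) (hq2 : q ^ 2 = a + κ ^ 2 * y ^ 2) :
    |p - q| ≤ κ * |x - y| := by
  have h1 : κ * |x| ≤ p := by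
    apply le_of_sq_le_sq _ hp.le
    rw [mul_pow, sq_abs]; linarith
  have h2 : κ * |y| ≤ q := by
    apply le_of_sq_le_sq _ hq.le
    rw [mul_pow, sq_abs]; linarith
  have h3 : |x + y| ≤ |x| + |y| := abs_add_le x y
  have h4 : |p - q| * (p + q) = κ * |x - y| * (κ * |x + y|) := by
    have : (p - q) * (p + q) = κ * (x - y) * (κ * (x + y)) := by nlinarith
    have h := congrArg abs this
    rwa [abs_mul, abs_mul, abs_mul, abs_mul, abs_of_nonneg hκ, abs_of_pos (add_pos hp hq)] at h
  have h5 : κ * |x + y| ≤ p + q := by nlinarith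
  have h6 : κ * |x - y| * (κ * |x + y|) ≤ κ * |x - y| * (p + q) := by gcongr
  rw [← h4] at h6
  exact le_of_mul_le_mul_right h6 (add_pos hp hq)

/-- One-dimensional Lojasiewicz inequality. -/
lemma lojasiewicz (f : ℝ → ℝ) (hf : AnalyticOnNhd ℝ f Set.univ) (h0 : f 0 ≠ 0)
    (δ M : ℝ) (hδ : 0 < δ) (hM : ∀ r, M ≤ r → δ ≤ |f r|) :
    ∃ n : ℕ, 1 ≤ n ∧ ∃ C > (0 : ℝ), ∀ r, 0 ≤ r → ∀ t, 0 ≤ t → t ≤ 1 →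
      (∀ z, f z = 0 → t ≤ |r - z|) → C * t ^ n ≤ |f r| := by
  have key : ∃ n : ℕ, 1 ≤ n ∧ ∃ C > (0 : ℝ), ∀ r ∈ Set.Icc 0 M, ∀ t, 0 ≤ t → t ≤ 1 →
      (∀ z, f z = 0 → t ≤ |r - z|) → C * t ^ n ≤ |f r| := by
    refine IsCompact.induction_on (p := fun s : Set ℝ => ∃ n : ℕ, 1 ≤ n ∧ ∃ C > (0 : ℝ),
      ∀ r ∈ s, ∀ t, 0 ≤ t → t ≤ 1 →
      (∀ z, f z = 0 → t ≤ |r - z|) → C * t ^ n ≤ |f r|) isCompact_Icc ?_ ?_ ?_ ?_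
    · exact ⟨1, le_rfl, 1, one_pos, fun r hr => absurd hr (Set.notMem_empty r)⟩
    · rintro s t hst ⟨n, hn, C, hC, h⟩
      exact ⟨n, hn, C, hC, fun r hr => h r (hst hr)⟩
    · rintro s t ⟨n, hn, C, hC, h⟩ ⟨n', hn', C', hC', h'⟩
      refine ⟨max n n', le_trans hn (le_max_left _ _), min C C', lt_min hC hC', ?_⟩
      intro r hr t ht ht1 hz
      rcases hr with hr | hr
      · refine le_trans ?_ (h r hr t ht ht1 hz)
        exact mul_le_mul (min_le_left _ _) (pow_le_pow_of_le_one ht ht1 (le_max_left _ _))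
          (by positivity) hC.le
      · refine le_trans ?_ (h' r hr t ht ht1 hz)
        exact mul_le_mul (min_le_right _ _) (pow_le_pow_of_le_one ht ht1 (le_max_right _ _))
          (by positivity) hC'.le
    · intro r0 _
      have hne : ¬ ∀ᶠ z in nhds r0, f z = 0 := by
        intro h
        exact h0 (hf.eqOn_zero_of_preconnected_of_eventuallyEq_zero isPreconnected_univ
          (Set.mem_univ r0) h (Set.mem_univ 0))
      obtain ⟨n, g, hg, hg0, hfg⟩ :=
        (hf r0 (Set.mem_univ r0)).exists_eventuallyEq_pow_smul_nonzero_iff.2 hne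
      have hgc : ∀ᶠ z in nhds r0, |g r0| / 2 < |g z| := by
        have : 0 < |g r0| := abs_pos.2 hg0
        exact hg.continuousAt.abs.eventually (lt_mem_nhds (by linarith))
      refine ⟨{z | f z = (z - r0) ^ n • g z ∧ |g r0| / 2 < |g z|},
        mem_nhdsWithin_of_mem_nhds (hfg.and hgc), n + 1, by omega, |g r0| / 2,
        half_pos (abs_pos.2 hg0), ?_⟩
      rintro r ⟨h1, h2⟩ t ht ht1 hz
      have h3 : t ^ (n + 1) ≤ |r - r0| ^ n := by
        rcases Nat.eq_zero_or_pos n with hn | hn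
        · subst hn; simpa using ht1
        · have hr0 : f r0 = 0 := by
            rw [hfg.self_of_nhds]; simp [hn.ne']
          calc t ^ (n + 1) ≤ t ^ n := pow_le_pow_of_le_one ht ht1 (by omega)
            _ ≤ _ := pow_le_pow_left₀ ht (hz r0 hr0) n
      rw [h1, smul_eq_mul, abs_mul, abs_pow, mul_comm]
      exact mul_le_mul h3 h2.le (by positivity) (by positivity)
  obtain ⟨n, hn, C, hC, h⟩ := key
  refine ⟨n, hn, min C δ, lt_min hC hδ, ?_⟩
  intro r hr t ht ht1 hz
  rcases le_total M r with hMr | hMr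
  · refine le_trans ?_ (hM r hMr)
    calc min C δ * t ^ n ≤ δ * 1 :=
          mul_le_mul (min_le_right _ _) (pow_le_one₀ ht ht1) (by positivity) hδ.le
      _ = δ := mul_one δ
  · refine le_trans ?_ (h r ⟨hr, hMr⟩ t ht ht1 hz)
    exact mul_le_mul_of_nonneg_right (min_le_left _ _) (by positivity)

/-- Denominator. -/
def dd (l m r : ℝ) : ℝ := Real.sqrt (m ^ 2 + l ^ 2 * (m ^ 2 - l ^ 2) * r ^ 2)

/-- The companion radius. -/
def ss (l m r : ℝ) : ℝ := l ^ 2 * r / (m * dd l m r)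

/-- The phase along the space-resonant set. -/
def ff (k l m e0 e1 e2 r : ℝ) : ℝ :=
  e0 * br k (r + e1 * e2 * ss l m r) - e1 * br l r - e2 * br m (ss l m r)

lemma dd_arg {l m : ℝ} (hl : 0 < l) (hlm : l ≤ m) (r : ℝ) : 0 < m ^ 2 + l ^ 2 * (m ^ 2 - l ^ 2) * r ^ 2 := by
  have h1 : 0 ≤ m ^ 2 - l ^ 2 := by nlinarith
  have : 0 < m := by linarith
  positivity

lemma dd_pos {l m : ℝ} (hl : 0 < l) (hlm : l ≤ m) (r : ℝ) : 0 < dd l m r := Real.sqrt_pos.2 (dd_arg hl hlm r)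

lemma dd_sq {l m : ℝ} (hl : 0 < l) (hlm : l ≤ m) (r : ℝ) : dd l m r ^ 2 = m ^ 2 + l ^ 2 * (m ^ 2 - l ^ 2) * r ^ 2 :=
  Real.sq_sqrt (dd_arg hl hlm r).le

lemma dd_ge {l m : ℝ} (hl : 0 < l) (hlm : l ≤ m) (r : ℝ) : m ≤ dd l m r := by
  apply Real.le_sqrt_of_sq_le
  have h1 : 0 ≤ m ^ 2 - l ^ 2 := by nlinarith
  have : 0 ≤ l ^ 2 * (m ^ 2 - l ^ 2) * r ^ 2 := by positivity
  linarith

lemma ss_lip {l m : ℝ} (hl : 0 < l) (hlm : l ≤ m) (r z : ℝ) : |ss l m r - ss l m z| ≤ l ^ 2 / m * (2 / m) * |r - z| := by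
  have hm : 0 < m := by linarith
  have h1 : 0 ≤ m ^ 2 - l ^ 2 := by nlinarith
  set κ := l * Real.sqrt (m ^ 2 - l ^ 2) with hκ
  have hκ0 : 0 ≤ κ := by positivity
  have hκ2 : κ ^ 2 = l ^ 2 * (m ^ 2 - l ^ 2) := by rw [hκ, mul_pow, Real.sq_sqrt h1]
  have hD := dd_sq hl hlm r
  have hE := dd_sq hl hlm z
  have hD0 := dd_pos hl hlm r
  have hE0 := dd_pos hl hlm z
  have hDm := dd_ge hl hlm r
  unfold ss
  generalize dd l m r = D at *
  generalize dd l m z = E at *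
  rw [← hκ2] at hD hE
  have hED : |E - D| ≤ κ * |r - z| := by
    rw [abs_sub_comm E D]
    exact hyp_lip (m ^ 2) κ r z D E (by positivity) hκ0 hD0 hE0 hD hE
  have h2 : κ * |z| ≤ E := by
    apply le_of_sq_le_sq _ hE0.le
    rw [mul_pow, sq_abs]; nlinarith
  have e : l ^ 2 * r / (m * D) - l ^ 2 * z / (m * E)
      = l ^ 2 / m * (((r - z) * E + z * (E - D)) / (D * E)) := by
    field_simp; ring
  rw [e, abs_mul, abs_of_pos (by positivity : 0 < l ^ 2 / m), mul_assoc]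
  gcongr
  rw [abs_div, abs_of_pos (mul_pos hD0 hE0), div_le_iff₀ (mul_pos hD0 hE0)]
  have h3 : |(r - z) * E + z * (E - D)| ≤ 2 * |r - z| * E := by
    refine (abs_add_le _ _).trans ?_
    rw [abs_mul, abs_mul, abs_of_pos hE0]
    have : |z| * |E - D| ≤ |z| * (κ * |r - z|) := by gcongr
    have : (κ * |z|) * |r - z| ≤ E * |r - z| := by gcongr
    nlinarith
  have h4 : 2 * |r - z| * E * 1 ≤ 2 * |r - z| * E * (D / m) := by
    gcongr
    rwa [one_le_div hm]
  have h5 : 2 / m * |r - z| * (D * E) = 2 * |r - z| * E * (D / m) := by ring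
  rw [h5]; linarith

lemma ss_sq {l m : ℝ} (hl : 0 < l) (hlm : l ≤ m) (r : ℝ) : (1 + m ^ 2 * ss l m r ^ 2) = (m * br l r / dd l m r) ^ 2 := by
  have hm : 0 < m := by linarith
  have hD0 := dd_pos hl hlm r
  rw [div_pow, mul_pow, br_sq, ss, div_pow, eq_div_iff (by positivity)]
  have hD := dd_sq hl hlm r
  field_simp
  rw [hD]; ring

lemma br_ss {l m : ℝ} (hl : 0 < l) (hlm : l ≤ m) (r : ℝ) : br m (ss l m r) = m * br l r / dd l m r := by
  have hm : 0 < m := by linarith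
  have hD0 := dd_pos hl hlm r
  have := br_pos l r
  rw [br, ss_sq hl hlm, Real.sqrt_sq (by positivity)]

lemma ss_eq {l m : ℝ} (hl : 0 < l) (hlm : l ≤ m) (r : ℝ) : m ^ 2 * ss l m r / br m (ss l m r) = l ^ 2 * r / br l r := by
  have hm : 0 < m := by linarith
  have hD0 := dd_pos hl hlm r
  have := br_pos l r
  rw [br_ss hl hlm, ss]
  field_simp

lemma ss_nonneg {l m : ℝ} (hl : 0 < l) (hlm : l ≤ m) (r : ℝ) (hr : 0 ≤ r) : 0 ≤ ss l m r := by
  have hm : 0 < m := by linarith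
  have hD0 := dd_pos hl hlm r
  unfold ss; positivity

lemma ss_unique {l m : ℝ} (hl : 0 < l) (hlm : l ≤ m) (r s : ℝ) (hr : 0 ≤ r) (hs : 0 ≤ s)
    (h : m ^ 2 * s * br l r = l ^ 2 * r * br m s) : s = ss l m r := by
  have hm : 0 < m := by linarith
  have hD0 := dd_pos hl hlm r
  rw [ss, eq_div_iff (by positivity)]
  have h2 : (m ^ 2 * s * br l r) ^ 2 = (l ^ 2 * r * br m s) ^ 2 := by rw [h]
  rw [mul_pow, mul_pow _ (br m s), br_sq, br_sq] at h2
  have h3 : (s * (m * dd l m r)) ^ 2 = (l ^ 2 * r) ^ 2 := by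
    rw [mul_pow, mul_pow m, dd_sq hl hlm]; nlinarith
  exact (sq_eq_sq₀ (by positivity) (by positivity)).1 h3

lemma ss_bound {l m : ℝ} (hl : 0 < l) (hlm : l ≤ m) (hlt : l < m) : ∃ B > 0, ∀ r, 0 ≤ r → ss l m r ≤ B := by
  have hm : 0 < m := by linarith
  have h1 : 0 < m ^ 2 - l ^ 2 := by nlinarith
  set κ := l * Real.sqrt (m ^ 2 - l ^ 2) with hκ
  have hκ0 : 0 < κ := mul_pos hl (Real.sqrt_pos.2 h1)
  have hκ2 : κ ^ 2 = l ^ 2 * (m ^ 2 - l ^ 2) := by rw [hκ, mul_pow, Real.sq_sqrt h1.le]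
  refine ⟨l ^ 2 / (m * κ), by positivity, fun r hr => ?_⟩
  have hD0 := dd_pos hl hlm r
  have h2 : κ * r ≤ dd l m r := by
    apply le_of_sq_le_sq _ hD0.le
    rw [mul_pow, dd_sq hl hlm]; nlinarith
  rw [ss, div_le_div_iff₀ (by positivity) (by positivity)]
  have : l ^ 2 * m * (κ * r) ≤ l ^ 2 * m * dd l m r := by gcongr
  nlinarith

lemma br_analytic (a : ℝ) (g : ℝ → ℝ) (hg : AnalyticOnNhd ℝ g Set.univ) :
    AnalyticOnNhd ℝ (fun r => br a (g r)) Set.univ := by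
  intro x _
  apply ContDiffAt.analyticAt
  have h := (hg x (Set.mem_univ x)).contDiffAt (n := ⊤)
  unfold br
  exact (contDiffAt_const.add (contDiffAt_const.mul (h.pow 2))).sqrt (by positivity)

lemma ss_analytic {l m : ℝ} (hl : 0 < l) (hlm : l ≤ m) :
    AnalyticOnNhd ℝ (ss l m) Set.univ := by
  intro x _
  apply ContDiffAt.analyticAt
  have hm : 0 < m := by linarith
  have hd := dd_pos hl hlm x
  have hd' : ContDiffAt ℝ ⊤ (dd l m) x := by
    unfold dd
    exact (contDiffAt_const.add (contDiffAt_const.mul (contDiffAt_id.pow 2))).sqrt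
      (dd_arg hl hlm x).ne'
  unfold ss
  exact (contDiffAt_const.mul contDiffAt_id).div (contDiffAt_const.mul hd') (by positivity)

lemma ff_analytic {l m : ℝ} (hl : 0 < l) (hlm : l ≤ m) (k e0 e1 e2 : ℝ) :
    AnalyticOnNhd ℝ (ff k l m e0 e1 e2) Set.univ := by
  have hs := ss_analytic hl hlm
  have h1 := br_analytic k (fun r => r + e1 * e2 * ss l m r)
    (analyticOnNhd_id.add (analyticOnNhd_const.mul hs))
  have h2 := br_analytic l (fun r => r) analyticOnNhd_id
  have h3 := br_analytic m (fun r => ss l m r) hs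
  exact ((analyticOnNhd_const.mul h1).sub (analyticOnNhd_const.mul h2)).sub
    (analyticOnNhd_const.mul h3)

lemma br_zero (a : ℝ) : br a 0 = 1 := by simp [br]

lemma br_upper2 (a x : ℝ) (h : 0 < a * x) : br a x ≤ a * x + 1 / (a * x) := by
  rw [br, Real.sqrt_le_left (by positivity)]
  have : a * x * (1 / (a * x)) = 1 := mul_one_div_cancel h.ne'
  have : 0 ≤ (1 / (a * x)) ^ 2 := by positivity
  nlinarith

lemma ss_same {l : ℝ} (hl : 0 < l) (r : ℝ) : ss l l r = r := by
  have : dd l l r = l := by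
    rw [dd, sub_self]; simp [hl.le]
  rw [ss, this]; field_simp

lemma ff_zero (k l m e0 e1 e2 : ℝ) (he0 : e0 = 1 ∨ e0 = -1) (he1 : e1 = 1 ∨ e1 = -1)
    (he2 : e2 = 1 ∨ e2 = -1) : ff k l m e0 e1 e2 0 ≠ 0 := by
  have : ss l m 0 = 0 := by simp [ss]
  rw [ff, this, mul_zero, add_zero, br_zero, br_zero, br_zero]
  rcases he0 with rfl | rfl <;> rcases he1 with rfl | rfl <;> rcases he2 with rfl | rfl <;>
    norm_num

lemma ff_inf_same {k l : ℝ} (hk : 0 < k) (hl : 0 < l) (e1 e2 : ℝ)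
    (he1 : e1 = 1 ∨ e1 = -1) (he2 : e2 = 1 ∨ e2 = -1)
    (hz : ∃ z, ff k l l 1 e1 e2 z = 0) :
    ∃ δ > 0, ∃ M, ∀ r, M ≤ r → δ ≤ |ff k l l 1 e1 e2 r| := by
  refine ⟨1, one_pos, ?_⟩
  simp only [ff, ss_same hl] at hz ⊢
  rcases he1 with rfl | rfl <;> rcases he2 with rfl | rfl
  · rcases lt_trichotomy k l with h | h | h
    · refine ⟨1 / (l - k), fun r hr => le_abs.2 (Or.inr ?_)⟩
      have h0 : 0 < l - k := by linarith
      rw [div_le_iff₀ h0] at hr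
      have hr0 : 0 < r := by
        by_contra hh
        nlinarith
      have a1 := br_upper k (r + 1 * 1 * r) (by positivity)
      have a2 := br_lower l r
      nlinarith
    · exfalso
      subst h
      obtain ⟨z, hz⟩ := hz
      have h1 : br k (z + 1 * 1 * z) = 2 * br k z := by linarith
      have h2 := br_sq k (z + 1 * 1 * z)
      rw [h1, mul_pow, br_sq] at h2
      nlinarith
    · refine ⟨2 / (k - l), fun r hr => le_abs.2 (Or.inl ?_)⟩
      have h0 : 0 < k - l := by linarith
      rw [div_le_iff₀ h0] at hr
      have hr0 : 0 < r := by
        by_contra hh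
        nlinarith
      have a1 := br_upper l r (by positivity)
      have a2 := br_lower k (r + 1 * 1 * r)
      nlinarith
  · refine ⟨0, fun r hr => ?_⟩
    have : r + 1 * -1 * r = 0 := by ring
    rw [this, br_zero]
    simp
  · refine ⟨0, fun r hr => ?_⟩
    have : r + -1 * 1 * r = 0 := by ring
    rw [this, br_zero]
    simp
  · refine ⟨0, fun r hr => le_abs.2 (Or.inl ?_)⟩
    have := br_pos l r
    have := br_ge_one k (r + -1 * -1 * r)
    linarith

lemma ff_inf_lt {k l m : ℝ} (hk : 0 < k) (hl : 0 < l) (hlm : l < m) (hkk : k = l ∨ k = m)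
    (e1 e2 : ℝ) (he1 : e1 = 1 ∨ e1 = -1) (he2 : e2 = 1 ∨ e2 = -1) :
    ∃ δ > 0, ∃ M, ∀ r, M ≤ r → δ ≤ |ff k l m 1 e1 e2 r| := by
  have hm : 0 < m := by linarith
  obtain ⟨B, hB, hsB⟩ := ss_bound hl hlm.le hlm
  have hs0 := ss_nonneg hl hlm.le
  have hml : 0 < m - l := by linarith
  rcases he1 with rfl | rfl
  · rcases hkk with rfl | rfl
    · refine ⟨1 / (1 + 2 * m * B) / 2, by positivity, 2 * (1 + 2 * m * B) / k, fun r hr => ?_⟩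
      have hr0 : 0 < r := lt_of_lt_of_le (by positivity) hr
      have hs := hs0 r hr0.le
      have hs' := hsB r hr0.le
      unfold ff
      generalize ss k m r = s at *
      have hms : m * s ≤ m * B := by gcongr
      have hks : k * s ≤ m * s := by gcongr
      have hb : 1 / (1 + 2 * m * B) ≤ br m s - m * s := by
        have b1 := br_upper m s (by positivity)
        have b2 := br_sq m s
        have b3 := br_pos m s
        have b4 : br m s - m * s = 1 / (br m s + m * s) := by
          rw [eq_div_iff (by positivity)]; nlinarith
        rw [b4]
        exact one_div_le_one_div_of_le (by positivity) (by linarith)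
      have hkr : 1 / (k * r) ≤ 1 / (1 + 2 * m * B) / 2 := by
        rw [div_div]
        rw [div_le_iff₀ hk] at hr
        exact one_div_le_one_div_of_le (by positivity) (by linarith)
      rcases he2 with rfl | rfl
      · refine le_abs.2 (Or.inr ?_)
        have c1 := br_lower k r
        have c2 := br_upper2 k (r + 1 * 1 * s) (by positivity)
        have c3 : 1 / (k * (r + 1 * 1 * s)) ≤ 1 / (k * r) := by
          gcongr
          linarith
        nlinarith
      · refine le_abs.2 (Or.inl ?_)
        have c1 := br_lower k (r + 1 * -1 * s)
        have c2 := br_upper2 k r (by positivity)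
        have c3 : k * (r + 1 * -1 * s) = k * r - k * s := by ring
        rw [c3] at c1
        generalize br k (r + 1 * -1 * s) = y1 at *
        generalize 1 / (k * r) = y2 at *
        generalize 1 / (1 + 2 * m * B) = y3 at *
        linarith
    · refine ⟨1, one_pos, (3 + 2 * k * B) / (k - l), fun r hr => le_abs.2 (Or.inl ?_)⟩
      have hr0 : 0 < r := lt_of_lt_of_le (by positivity) hr
      have hs := hs0 r hr0.le
      have hs' := hsB r hr0.le
      unfold ff
      generalize ss l k r = s at *
      rw [div_le_iff₀ hml] at hr
      have hms : k * s ≤ k * B := by gcongr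
      have b1 := br_upper k s (by positivity)
      have b2 := br_upper l r (by positivity)
      have b3 := br_lower k (r + 1 * e2 * s)
      have b4 := br_pos k s
      rcases he2 with rfl | rfl <;> nlinarith
  · refine ⟨1, one_pos, (2 + m * B) / l, fun r hr => le_abs.2 (Or.inl ?_)⟩
    have hr0 : 0 < r := lt_of_lt_of_le (by positivity) hr
    have hs := hs0 r hr0.le
    have hs' := hsB r hr0.le
    unfold ff
    generalize ss l m r = s at *
    rw [div_le_iff₀ hl] at hr
    have hms : m * s ≤ m * B := by gcongr
    have b1 := br_upper m s (by positivity)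
    have b2 := br_lower l r
    have b3 := br_pos k (r + -1 * e2 * s)
    have b4 := br_pos m s
    rcases he2 with rfl | rfl <;> nlinarith

lemma ff_neg (k l m e0 e1 e2 r : ℝ) :
    ff k l m (-e0) (-e1) (-e2) r = - ff k l m e0 e1 e2 r := by
  unfold ff
  rw [neg_mul_neg]; ring

lemma ff_inf {k l m : ℝ} (hk : 0 < k) (hl : 0 < l) (hlm : l ≤ m)
    (hkk : l = m ∨ k = l ∨ k = m) (e0 e1 e2 : ℝ) (he0 : e0 = 1 ∨ e0 = -1)
    (he1 : e1 = 1 ∨ e1 = -1) (he2 : e2 = 1 ∨ e2 = -1)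
    (hz : ∃ z, ff k l m e0 e1 e2 z = 0) :
    ∃ δ > 0, ∃ M, ∀ r, M ≤ r → δ ≤ |ff k l m e0 e1 e2 r| := by
  have main : ∀ e1 e2 : ℝ, (e1 = 1 ∨ e1 = -1) → (e2 = 1 ∨ e2 = -1) →
      (∃ z, ff k l m 1 e1 e2 z = 0) →
      ∃ δ > 0, ∃ M, ∀ r, M ≤ r → δ ≤ |ff k l m 1 e1 e2 r| := by
    intro e1 e2 he1 he2 hz
    rcases hlm.eq_or_lt with h | h
    · subst h
      exact ff_inf_same hk hl e1 e2 he1 he2 hz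
    · exact ff_inf_lt hk hl h (hkk.resolve_left h.ne) e1 e2 he1 he2
  rcases he0 with rfl | rfl
  · exact main e1 e2 he1 he2 hz
  · have e : ∀ r, ff k l m (-1) e1 e2 r = - ff k l m 1 (-e1) (-e2) r := by
      intro r
      rw [← ff_neg, neg_neg, neg_neg]
    simp only [e, neg_eq_zero, abs_neg] at hz ⊢
    apply main _ _ _ _ hz
    · rcases he1 with rfl | rfl <;> simp
    · rcases he2 with rfl | rfl <;> simp

/-- Space resonance in the coordinates (η, ζ = ξ - η). -/
def SR (l m e1 e2 : ℝ) (η ζ : R3) : Prop :=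
  (e1 * l ^ 2 / br l ‖η‖) • η = (e2 * m ^ 2 / br m ‖ζ‖) • ζ

/-- The phase in the coordinates (η, ζ = ξ - η). -/
def ph (k l m e0 e1 e2 : ℝ) (η ζ : R3) : ℝ :=
  e0 * br k ‖η + ζ‖ - e1 * br l ‖η‖ - e2 * br m ‖ζ‖

lemma br_smul (a z : ℝ) (e : R3) (he : ‖e‖ = 1) : br a ‖z • e‖ = br a z := by
  rw [br, br, norm_smul, he, mul_one, Real.norm_eq_abs, sq_abs]

lemma sign_sq {e : ℝ} (he : e = 1 ∨ e = -1) : e ^ 2 = 1 := by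
  rcases he with rfl | rfl <;> norm_num

lemma sign_abs {e : ℝ} (he : e = 1 ∨ e = -1) : |e| = 1 := by
  rcases he with rfl | rfl <;> norm_num

lemma ph_ff (k l m e0 e1 e2 : ℝ) (he1 : e1 = 1 ∨ e1 = -1) (he2 : e2 = 1 ∨ e2 = -1)
    (r : ℝ) (e : R3) (he : ‖e‖ = 1) :
    ph k l m e0 e1 e2 (r • e) ((e1 * e2 * ss l m r) • e) = ff k l m e0 e1 e2 r := by
  rw [ph, ← add_smul, br_smul _ _ _ he, br_smul _ _ _ he, br_smul _ _ _ he, ff]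
  have : br m (e1 * e2 * ss l m r) = br m (ss l m r) := by
    rw [br, br, mul_pow, mul_pow, sign_sq he1, sign_sq he2, one_mul, one_mul]
  rw [this]

lemma SR_of {l m : ℝ} (hl : 0 < l) (hlm : l ≤ m) (e1 e2 : ℝ)
    (he1 : e1 = 1 ∨ e1 = -1) (he2 : e2 = 1 ∨ e2 = -1) (z : ℝ) (e : R3) (he : ‖e‖ = 1) :
    SR l m e1 e2 (z • e) ((e1 * e2 * ss l m z) • e) := by
  rw [SR, br_smul _ _ _ he, br_smul _ _ _ he, smul_smul, smul_smul]
  have : br m (e1 * e2 * ss l m z) = br m (ss l m z) := by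
    rw [br, br, mul_pow, mul_pow, sign_sq he1, sign_sq he2, one_mul, one_mul]
  rw [this]
  congr 1
  have h := ss_eq hl hlm z
  calc e1 * l ^ 2 / br l z * z = e1 * (l ^ 2 * z / br l z) := by ring
    _ = e1 * (m ^ 2 * ss l m z / br m (ss l m z)) * e2 ^ 2 := by rw [h, sign_sq he2, mul_one]
    _ = _ := by ring

lemma SR_param {l m : ℝ} (hl : 0 < l) (hlm : l ≤ m) (e1 e2 : ℝ)
    (he1 : e1 = 1 ∨ e1 = -1) (he2 : e2 = 1 ∨ e2 = -1) (η ζ : R3) (h : SR l m e1 e2 η ζ) :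
    ∃ e : R3, ‖e‖ = 1 ∧ η = ‖η‖ • e ∧ ζ = (e1 * e2 * ss l m ‖η‖) • e := by
  have hm : 0 < m := by linarith
  have hE : ∃ e : R3, ‖e‖ = 1 ∧ η = ‖η‖ • e := by
    by_cases h0 : η = 0
    · exact ⟨EuclideanSpace.single 0 1, by simp, by simp [h0]⟩
    · have : ‖η‖ ≠ 0 := norm_ne_zero_iff.2 h0
      exact ⟨‖η‖⁻¹ • η, by rw [norm_smul, norm_inv, norm_norm, inv_mul_cancel₀ this],
        by rw [smul_smul, mul_inv_cancel₀ this, one_smul]⟩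
  obtain ⟨e, he, hη⟩ := hE
  refine ⟨e, he, hη, ?_⟩
  unfold SR at h
  have hb1 := br_pos l ‖η‖
  have hb2 := br_pos m ‖ζ‖
  have hn := congrArg norm h
  rw [norm_smul, norm_smul, Real.norm_eq_abs, Real.norm_eq_abs, abs_div, abs_div, abs_mul, abs_mul,
    sign_abs he1, sign_abs he2, abs_of_pos hb1, abs_of_pos hb2, abs_sq, abs_sq] at hn
  have hn' : m ^ 2 * ‖ζ‖ * br l ‖η‖ = l ^ 2 * ‖η‖ * br m ‖ζ‖ := by
    field_simp at hn
    linarith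
  have hs := ss_unique hl hlm ‖η‖ ‖ζ‖ (norm_nonneg _) (norm_nonneg _) hn'
  rw [← hs]
  have h2 := congrArg (fun v => (e2 * br m ‖ζ‖ / m ^ 2) • v) h
  simp only [smul_smul] at h2
  have h3 : e2 * br m ‖ζ‖ / m ^ 2 * (e2 * m ^ 2 / br m ‖ζ‖) = 1 := by
    have := sign_sq he2
    field_simp
    linarith
  rw [h3, one_smul] at h2
  have h4 : e2 * br m ‖ζ‖ / m ^ 2 * (e1 * l ^ 2 / br l ‖η‖) * ‖η‖ = e1 * e2 * ‖ζ‖ := by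
    field_simp
    linear_combination (-e1 * e2) * hn'
  rw [← h4, mul_smul, ← hη, h2]

lemma key_le {k l m : ℝ} (hk : 0 < k) (hl : 0 < l) (hlm : l ≤ m)
    (hkk : l = m ∨ k = l ∨ k = m) (e0 e1 e2 : ℝ) (he0 : e0 = 1 ∨ e0 = -1)
    (he1 : e1 = 1 ∨ e1 = -1) (he2 : e2 = 1 ∨ e2 = -1)
    (hne : ∃ η ζ, SR l m e1 e2 η ζ ∧ ph k l m e0 e1 e2 η ζ = 0) :
    ∃ n : ℕ, 1 ≤ n ∧ ∃ C > (0 : ℝ), ∀ η ζ, SR l m e1 e2 η ζ → ∀ t, 0 ≤ t → t ≤ 1 →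
      (∀ η' ζ', SR l m e1 e2 η' ζ' → ph k l m e0 e1 e2 η' ζ' = 0 →
        t ≤ ‖η - η'‖ + ‖ζ - ζ'‖) → C * t ^ n ≤ |ph k l m e0 e1 e2 η ζ| := by
  have hm : 0 < m := by linarith
  have hz : ∃ z, ff k l m e0 e1 e2 z = 0 := by
    obtain ⟨η, ζ, h1, h2⟩ := hne
    obtain ⟨e, he, hη, hζ⟩ := SR_param hl hlm e1 e2 he1 he2 η ζ h1
    refine ⟨‖η‖, ?_⟩
    rw [← ph_ff k l m e0 e1 e2 he1 he2 ‖η‖ e he, ← hη, ← hζ, h2]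
  obtain ⟨δ, hδ, M, hM⟩ := ff_inf hk hl hlm hkk e0 e1 e2 he0 he1 he2 hz
  obtain ⟨n, hn, C, hC, h⟩ := lojasiewicz _ (ff_analytic hl hlm k e0 e1 e2)
    (ff_zero k l m e0 e1 e2 he0 he1 he2) δ M hδ hM
  set K := 1 + l ^ 2 / m * (2 / m) with hK
  have hK1 : 1 ≤ K := by
    have : 0 < l ^ 2 / m * (2 / m) := by positivity
    linarith
  have hK0 : 0 < K := by linarith
  refine ⟨n, hn, C / K ^ n, by positivity, ?_⟩
  intro η ζ hS t ht ht1 hd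
  obtain ⟨e, he, hη, hζ⟩ := SR_param hl hlm e1 e2 he1 he2 η ζ hS
  have hph : ph k l m e0 e1 e2 η ζ = ff k l m e0 e1 e2 ‖η‖ := by
    rw [← ph_ff k l m e0 e1 e2 he1 he2 ‖η‖ e he, ← hη, ← hζ]
  rw [hph]
  have := h ‖η‖ (norm_nonneg _) (t / K) (by positivity)
    ((div_le_one hK0).2 (ht1.trans hK1)) ?_
  · refine le_trans (le_of_eq ?_) this
    rw [div_pow]; ring
  · intro z hz
    rw [div_le_iff₀ hK0]
    refine (hd (z • e) ((e1 * e2 * ss l m z) • e) (SR_of hl hlm e1 e2 he1 he2 z e he)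
      (by rw [ph_ff k l m e0 e1 e2 he1 he2 z e he, hz])).trans ?_
    have a1 : ‖η - z • e‖ = |‖η‖ - z| := by
      nth_rewrite 1 [hη]
      rw [← sub_smul, norm_smul, he, mul_one, Real.norm_eq_abs]
    have a2 : ‖ζ - (e1 * e2 * ss l m z) • e‖ = |ss l m ‖η‖ - ss l m z| := by
      rw [hζ, ← sub_smul, ← mul_sub, norm_smul, he, mul_one, Real.norm_eq_abs, abs_mul, abs_mul,
        sign_abs he1, sign_abs he2, one_mul, one_mul]
    rw [a1, a2, hK]
    have := ss_lip hl hlm ‖η‖ z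
    linarith

lemma key {k l m : ℝ} (hk : 0 < k) (hl : 0 < l) (hm : 0 < m)
    (hkk : l = m ∨ k = l ∨ k = m) (e0 e1 e2 : ℝ) (he0 : e0 = 1 ∨ e0 = -1)
    (he1 : e1 = 1 ∨ e1 = -1) (he2 : e2 = 1 ∨ e2 = -1)
    (hne : ∃ η ζ, SR l m e1 e2 η ζ ∧ ph k l m e0 e1 e2 η ζ = 0) :
    ∃ n : ℕ, 1 ≤ n ∧ ∃ C > (0 : ℝ), ∀ η ζ, SR l m e1 e2 η ζ → ∀ t, 0 ≤ t → t ≤ 1 →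
      (∀ η' ζ', SR l m e1 e2 η' ζ' → ph k l m e0 e1 e2 η' ζ' = 0 →
        t ≤ ‖η - η'‖ + ‖ζ - ζ'‖) → C * t ^ n ≤ |ph k l m e0 e1 e2 η ζ| := by
  rcases le_total l m with h | h
  · exact key_le hk hl h hkk e0 e1 e2 he0 he1 he2 hne
  · have hS : ∀ η ζ, SR m l e2 e1 ζ η ↔ SR l m e1 e2 η ζ := fun η ζ => eq_comm
    have hP : ∀ η ζ, ph k m l e0 e2 e1 ζ η = ph k l m e0 e1 e2 η ζ := by
      intro η ζ
      unfold ph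
      rw [add_comm ζ η]; ring
    obtain ⟨η, ζ, h1, h2⟩ := hne
    obtain ⟨n, hn, C, hC, hh⟩ := key_le hk hm h (by tauto) e0 e2 e1 he0 he2 he1
      ⟨ζ, η, (hS η ζ).2 h1, (hP η ζ).trans h2⟩
    refine ⟨n, hn, C, hC, fun η ζ hs t ht ht1 hd => ?_⟩
    rw [← hP]
    refine hh ζ η ((hS η ζ).2 hs) t ht ht1 fun ζ' η' hs' hp' => ?_
    rw [add_comm]
    exact hd η' ζ' ((hS _ _).1 hs') ((hP _ _).symm.trans hp')

lemma phase_eq (k l m e0 e1 e2 : ℝ) (ξ η : R3) :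
    phase k l m e0 e1 e2 ξ η = ph k l m e0 e1 e2 η (ξ - η) := by
  rw [ph, add_sub_cancel]; rfl

lemma br_grad (a : ℝ) (v η : R3) :
    HasFDerivAt (fun η : R3 => br a ‖η - v‖)
      (InnerProductSpace.toDual ℝ R3 ((a ^ 2 / br a ‖η - v‖) • (η - v))) η := by
  have h1 : HasFDerivAt (fun η : R3 => η - v) (ContinuousLinearMap.id ℝ R3) η :=
    (hasFDerivAt_id η).sub_const v
  have h2 := ((h1.norm_sq.const_mul (a ^ 2)).const_add 1).sqrt (by positivity)
  unfold br
  refine h2.congr_fderiv ?_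
  ext1 w
  have : 0 < Real.sqrt (1 + a ^ 2 * ‖η - v‖ ^ 2) := br_pos a ‖η - v‖
  simp only [ContinuousLinearMap.smul_apply, ContinuousLinearMap.comp_apply,
    ContinuousLinearMap.id_apply, innerSL_apply_apply, InnerProductSpace.toDual_apply_apply,
    inner_smul_left, smul_eq_mul, nsmul_eq_mul, Nat.cast_ofNat, conj_trivial]
  field_simp

lemma space_iff (k l m e0 e1 e2 : ℝ) (p : R3 × R3) :
    p ∈ SpaceRes k l m e0 e1 e2 ↔ SR l m e1 e2 p.2 (p.1 - p.2) := by
  obtain ⟨ξ, η⟩ := p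
  have h1 := br_grad l 0 η
  have h2 := br_grad m ξ η
  have h3 := ((hasFDerivAt_const (e0 * br k ‖ξ‖) η).sub (h1.const_mul e1)).sub (h2.const_mul e2)
  have h4 : HasGradientAt (fun η => phase k l m e0 e1 e2 ξ η)
      ((e2 * m ^ 2 / br m ‖ξ - η‖) • (ξ - η) - (e1 * l ^ 2 / br l ‖η‖) • η) η := by
    rw [hasGradientAt_iff_hasFDerivAt]
    have hfun : (fun η => phase k l m e0 e1 e2 ξ η) =
        ((fun _ => e0 * br k ‖ξ‖) - fun y => e1 * br l ‖y - 0‖) - fun y => e2 * br m ‖y - ξ‖ := by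
      funext w
      simp only [phase, br, sub_zero, Pi.sub_apply, norm_sub_rev ξ w]
    rw [hfun]
    refine h3.congr_fderiv ?_
    ext1 w
    rw [norm_sub_rev ξ η]
    simp only [ContinuousLinearMap.sub_apply, ContinuousLinearMap.zero_apply,
      ContinuousLinearMap.smul_apply, InnerProductSpace.toDual_apply_apply,
      inner_smul_left, inner_sub_left, smul_eq_mul, conj_trivial, sub_zero]
    ring
  show gradient _ _ = 0 ↔ _
  rw [h4.gradient, sub_eq_zero]
  exact eq_comm

lemma br_lip {a : ℝ} (ha : 0 < a) (x y : R3) : |br a ‖x‖ - br a ‖y‖| ≤ a * ‖x - y‖ := by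
  refine (hyp_lip 1 a ‖x‖ ‖y‖ _ _ zero_le_one ha.le (br_pos _ _) (br_pos _ _)
    (br_sq _ _) (br_sq _ _)).trans ?_
  gcongr
  exact abs_norm_sub_norm_le x y

lemma d6_ge1 (p q : R3 × R3) : ‖p.1 - q.1‖ ≤ d6 p q :=
  Real.le_sqrt_of_sq_le (by nlinarith [sq_nonneg ‖p.2 - q.2‖])

lemma d6_ge2 (p q : R3 × R3) : ‖p.2 - q.2‖ ≤ d6 p q :=
  Real.le_sqrt_of_sq_le (by nlinarith [sq_nonneg ‖p.1 - q.1‖])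

lemma d6_le (p q : R3 × R3) : d6 p q ≤ ‖p.1 - q.1‖ + ‖p.2 - q.2‖ := by
  rw [d6, Real.sqrt_le_left (by positivity)]
  nlinarith [norm_nonneg (p.1 - q.1), norm_nonneg (p.2 - q.2),
    mul_nonneg (norm_nonneg (p.1 - q.1)) (norm_nonneg (p.2 - q.2))]

lemma phase_lip {k l m : ℝ} (hk : 0 < k) (hl : 0 < l) (hm : 0 < m) (e0 e1 e2 : ℝ)
    (he0 : e0 = 1 ∨ e0 = -1) (he1 : e1 = 1 ∨ e1 = -1) (he2 : e2 = 1 ∨ e2 = -1)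
    (p q : R3 × R3) :
    |phase k l m e0 e1 e2 p.1 p.2 - phase k l m e0 e1 e2 q.1 q.2|
      ≤ (k + l + 2 * m) * d6 p q := by
  have a1 := br_lip hk p.1 q.1
  have a2 := br_lip hl p.2 q.2
  have a3 := br_lip hm (p.1 - p.2) (q.1 - q.2)
  have b1 := d6_ge1 p q
  have b2 := d6_ge2 p q
  have b3 : ‖(p.1 - p.2) - (q.1 - q.2)‖ ≤ 2 * d6 p q := by
    have : (p.1 - p.2) - (q.1 - q.2) = (p.1 - q.1) - (p.2 - q.2) := by abel
    rw [this]
    linarith [norm_sub_le (p.1 - q.1) (p.2 - q.2)]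
  have c1 : k * ‖p.1 - q.1‖ ≤ k * d6 p q := by gcongr
  have c2 : l * ‖p.2 - q.2‖ ≤ l * d6 p q := by gcongr
  have c3 : m * ‖(p.1 - p.2) - (q.1 - q.2)‖ ≤ m * (2 * d6 p q) := by gcongr
  have e : phase k l m e0 e1 e2 p.1 p.2 - phase k l m e0 e1 e2 q.1 q.2
      = e0 * (br k ‖p.1‖ - br k ‖q.1‖) - e1 * (br l ‖p.2‖ - br l ‖q.2‖)
        - e2 * (br m ‖p.1 - p.2‖ - br m ‖q.1 - q.2‖) := by
    unfold phase br; ring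
  rw [e]
  refine (abs_sub _ _).trans ?_
  have := abs_sub (e0 * (br k ‖p.1‖ - br k ‖q.1‖)) (e1 * (br l ‖p.2‖ - br l ‖q.2‖))
  rw [abs_mul, abs_mul, sign_abs he0, sign_abs he1] at this
  rw [abs_mul e2, sign_abs he2]
  linarith

/-- Finite-order intersection of the space and time resonant sets: for
`c > 0`, `k,ℓ,m ∈ {1,c}` and `ε₀,ε₁,ε₂ ∈ {±1}`, there exist `n ≥ 1`, `C > 0` and
`ε₁ > 0` such that for all `0 < ε < ε₁`,
`dist({dist(·,R) = ε} ∩ S, {dist(·,R) = ε} ∩ T) ≥ C εⁿ`. -/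
theorem stmt2 (c : ℝ) (hc : 0 < c) (k l m e0 e1 e2 : ℝ)
    (hk : k = 1 ∨ k = c) (hl : l = 1 ∨ l = c) (hm : m = 1 ∨ m = c)
    (he0 : e0 = 1 ∨ e0 = -1) (he1 : e1 = 1 ∨ e1 = -1) (he2 : e2 = 1 ∨ e2 = -1) :
    ∃ n : ℕ, 1 ≤ n ∧ ∃ C > (0 : ℝ), ∃ ε₁ > (0 : ℝ), ∀ ε : ℝ, 0 < ε → ε < ε₁ →
      ENNReal.ofReal (C * ε ^ n) ≤
        edistSets
          ({x | edistToSet x (SpaceTimeRes k l m e0 e1 e2) = ENNReal.ofReal ε}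
            ∩ SpaceRes k l m e0 e1 e2)
          ({x | edistToSet x (SpaceTimeRes k l m e0 e1 e2) = ENNReal.ofReal ε}
            ∩ TimeRes k l m e0 e1 e2) := by
  have hpos : ∀ {a : ℝ}, a = 1 ∨ a = c → 0 < a := by
    rintro a (rfl | rfl)
    · exact one_pos
    · exact hc
  have hk0 := hpos hk
  have hl0 := hpos hl
  have hm0 := hpos hm
  have hkk : l = m ∨ k = l ∨ k = m := by
    rcases hk with rfl | rfl <;> rcases hl with rfl | rfl <;> rcases hm with rfl | rfl <;> simp
  by_cases hne : (SpaceTimeRes k l m e0 e1 e2).Nonempty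
  · have hne' : ∃ η ζ, SR l m e1 e2 η ζ ∧ ph k l m e0 e1 e2 η ζ = 0 := by
      obtain ⟨p, hpS, hpT⟩ := hne
      exact ⟨p.2, p.1 - p.2, (space_iff _ _ _ _ _ _ _).1 hpS,
        (phase_eq _ _ _ _ _ _ _ _).symm.trans hpT⟩
    obtain ⟨n, hn, C, hC, h⟩ := key hk0 hl0 hm0 hkk e0 e1 e2 he0 he1 he2 hne'
    refine ⟨n, hn, C / 2 ^ n / (k + l + 2 * m), by positivity, 1, one_pos, ?_⟩
    intro ε hε hε1
    unfold edistSets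
    refine le_iInf₂ fun x hx => le_iInf₂ fun y hy => ENNReal.ofReal_le_ofReal ?_
    obtain ⟨hxd, hxS⟩ := hx
    obtain ⟨_, hyT⟩ := hy
    have hd : ∀ q ∈ SpaceTimeRes k l m e0 e1 e2, ε ≤ d6 x q := by
      intro q hq
      have h1 : ENNReal.ofReal ε ≤ ENNReal.ofReal (d6 x q) := by
        rw [← show edistToSet x _ = ENNReal.ofReal ε from hxd]
        exact iInf₂_le q hq
      exact (ENNReal.ofReal_le_ofReal_iff (Real.sqrt_nonneg _)).1 h1
    have h2 := h x.2 (x.1 - x.2) ((space_iff _ _ _ _ _ _ _).1 hxS) (ε / 2) (by positivity)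
      (by linarith) ?_
    · rw [← phase_eq] at h2
      have h3 := phase_lip hk0 hl0 hm0 e0 e1 e2 he0 he1 he2 x y
      rw [show phase k l m e0 e1 e2 y.1 y.2 = 0 from hyT, sub_zero] at h3
      have h4 := h2.trans h3
      rw [div_pow] at h4
      rw [div_mul_eq_mul_div, div_le_iff₀ (by positivity)]
      calc C / 2 ^ n * ε ^ n = C * (ε ^ n / 2 ^ n) := by ring
        _ ≤ _ := h4
        _ = _ := by ring
    · intro η' ζ' hs hp
      have hz : η' + ζ' - η' = ζ' := add_sub_cancel_left _ _
      have h5 := hd (η' + ζ', η') ⟨(space_iff _ _ _ _ _ _ _).2 (by simpa [hz] using hs), by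
        show phase k l m e0 e1 e2 (η' + ζ') η' = 0
        rw [phase_eq, hz, hp]⟩
      have h6 := h5.trans (d6_le _ _)
      simp only at h6
      have h7 : x.1 - (η' + ζ') = (x.2 - η') + (x.1 - x.2 - ζ') := by abel
      rw [h7] at h6
      have h8 := norm_add_le (x.2 - η') (x.1 - x.2 - ζ')
      have h9 := norm_nonneg (x.1 - x.2 - ζ')
      linarith
  · rw [Set.not_nonempty_iff_eq_empty] at hne
    refine ⟨1, le_rfl, 1, one_pos, 1, one_pos, ?_⟩
    intro ε hε hε1
    unfold edistSets
    refine le_iInf₂ fun x hx => ?_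
    exfalso
    have h1 : edistToSet x (SpaceTimeRes k l m e0 e1 e2) = ENNReal.ofReal ε := hx.1
    rw [hne] at h1
    simp [edistToSet] at h1
end
end

section
/- Explicit parameterization of a space-resonant set: Let c ≥ 1. For all ξ, η ∈ ℝ³, the equation η/√(1+|η|²) + c²(η−ξ)/√(1+c²|ξ−η|²) = 0 holds if and only if ξ = λ(|η|) η, where λ(r) := 1 + 1/√((c⁴−c²) r² + c⁴). (This is the vanishing of ∇_η φ for the phase φ(ξ,η) = ⟨ξ⟩_c − ⟨η⟩₁ − ⟨ξ−η⟩_c.) -/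
noncomputable section

/-- Explicit parameterization of the space-resonant set of the
phase `φ(ξ,η) = ⟨ξ⟩_c − ⟨η⟩₁ − ⟨ξ−η⟩_c`: for `c ≥ 1`, the equation
`η/√(1+|η|²) + c²(η−ξ)/√(1+c²|ξ−η|²) = 0` holds iff `ξ = λ(|η|) η` with
`λ(r) = 1 + 1/√((c⁴−c²)r² + c⁴)`. -/
theorem stmt17 (c : ℝ) (hc : 1 ≤ c) (ξ η : R3) :
    (Real.sqrt (1 + ‖η‖ ^ 2))⁻¹ • η
        + (c ^ 2 / Real.sqrt (1 + c ^ 2 * ‖ξ - η‖ ^ 2)) • (η - ξ) = 0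
      ↔ ξ = (1 + 1 / Real.sqrt ((c ^ 4 - c ^ 2) * ‖η‖ ^ 2 + c ^ 4)) • η := by
  have hc0 : 0 < c := by linarith
  have hc2 : 0 ≤ c ^ 4 - c ^ 2 := by
    nlinarith [mul_nonneg (sq_nonneg c) (by nlinarith : (0 : ℝ) ≤ c ^ 2 - 1)]
  have hSpos : 0 < (c ^ 4 - c ^ 2) * ‖η‖ ^ 2 + c ^ 4 := by positivity
  obtain ⟨v, rfl⟩ : ∃ v, ξ = η + v := ⟨ξ - η, by abel⟩
  have e1 : η + v - η = v := by abel
  have e2 : η - (η + v) = -v := by abel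
  rw [e1, e2, add_smul, one_smul, add_right_inj, smul_neg, ← sub_eq_add_neg, sub_eq_zero]
  have hA : 0 < √(1 + ‖η‖ ^ 2) := Real.sqrt_pos.2 (by positivity)
  have hA2 : √(1 + ‖η‖ ^ 2) ^ 2 = 1 + ‖η‖ ^ 2 := Real.sq_sqrt (by positivity)
  have hB : 0 < √(1 + c ^ 2 * ‖v‖ ^ 2) := Real.sqrt_pos.2 (by positivity)
  have hB2 : √(1 + c ^ 2 * ‖v‖ ^ 2) ^ 2 = 1 + c ^ 2 * ‖v‖ ^ 2 := Real.sq_sqrt (by positivity)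
  have hS := Real.sqrt_pos.2 hSpos
  have hS2 := Real.sq_sqrt hSpos.le
  set A := √(1 + ‖η‖ ^ 2)
  set B := √(1 + c ^ 2 * ‖v‖ ^ 2)
  set S := √((c ^ 4 - c ^ 2) * ‖η‖ ^ 2 + c ^ 4)
  constructor
  · intro h
    have hv : v = (B / (c ^ 2 * A)) • η := by
      have h2 := congrArg (fun w => (B / c ^ 2) • w) h
      simp only [smul_smul] at h2
      have e3 : B / c ^ 2 * (c ^ 2 / B) = 1 := by field_simp
      have e4 : B / c ^ 2 * A⁻¹ = B / (c ^ 2 * A) := by field_simp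
      rw [e3, e4, one_smul] at h2
      exact h2.symm
    obtain ⟨t, ht⟩ : ∃ t, t = B / (c ^ 2 * A) := ⟨_, rfl⟩
    have htp : 0 < t := by rw [ht]; positivity
    have hBt : B = t * c ^ 2 * A := by rw [ht]; field_simp
    rw [← ht] at hv
    have hn : ‖v‖ = t * ‖η‖ := by rw [hv, norm_smul, Real.norm_of_nonneg htp.le]
    rw [hn, hBt] at hB2
    have hsq : (t * S) ^ 2 = 1 := by
      rw [mul_pow, hS2]
      have h5 : (t * c ^ 2 * A) ^ 2 = t ^ 2 * c ^ 4 * (1 + ‖η‖ ^ 2) := by rw [← hA2]; ring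
      rw [h5] at hB2
      linear_combination hB2
    have h1 : t * S = 1 := by
      have : 0 < t * S := by positivity
      nlinarith
    have h6 : t = 1 / S := by rw [eq_div_iff hS.ne', h1]
    rw [hv, h6]
  · intro hv
    have hn : ‖v‖ = 1 / S * ‖η‖ := by
      rw [hv, norm_smul, Real.norm_of_nonneg (by positivity)]
    have hBS : B * S = c ^ 2 * A := by
      have h7 : (B * S) ^ 2 = (c ^ 2 * A) ^ 2 := by
        rw [mul_pow, mul_pow, hB2, hA2, hn]
        have h8 : (1 + c ^ 2 * (1 / S * ‖η‖) ^ 2) * S ^ 2 = S ^ 2 + c ^ 2 * ‖η‖ ^ 2 := by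
          field_simp
        rw [h8, hS2]
        ring
      exact (pow_left_inj₀ (by positivity) (by positivity) two_ne_zero).1 h7
    have h9 : c ^ 2 / B * (1 / S) = A⁻¹ := by
      rw [div_mul_div_comm, hBS]
      field_simp
    calc A⁻¹ • η = (c ^ 2 / B * (1 / S)) • η := by rw [h9]
      _ = (c ^ 2 / B) • ((1 / S) • η) := by rw [smul_smul]
      _ = (c ^ 2 / B) • v := by rw [← hv]
end
end

section
/- Nonvanishing limit of the phase along the space-resonant set at high frequencies: Let c > 1 and define λ(r) := 1 + 1/√((c⁴−c²) r² + c⁴) for r ≥ 0. Then lim_{r→∞} [ √(1 + λ(r)² r²) − √(1 + r²) − √(1 + c² (λ(r)−1)² r²) ] = −√(c²−1)/c. In particular this limit is nonzero, so the phase φ(ξ,η) = ⟨ξ⟩₁ − ⟨η⟩₁ − ⟨ξ−η⟩_c, evaluated along the curve (ξ,η) = (λ(r) r ω, r ω) for any unit vector ω, stays bounded away from zero for all sufficiently large r. -/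
open Filter

noncomputable section

/-- λ(r) = 1 + 1/√((c⁴−c²)r² + c⁴), the colinearity factor parameterizing the
space-resonant set of the phase φ(ξ,η) = ⟨ξ⟩₁ − ⟨η⟩₁ − ⟨ξ−η⟩_c. -/
def lam (c r : ℝ) : ℝ := 1 + 1 / Real.sqrt ((c ^ 4 - c ^ 2) * r ^ 2 + c ^ 4)

lemma g_tendsto : Tendsto (fun x : ℝ => Real.sqrt (1 + x ^ 2) - x) atTop (nhds 0) := by
  refine squeeze_zero' (g := fun x : ℝ => x⁻¹) ?_ ?_ tendsto_inv_atTop_zero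
  · filter_upwards [eventually_gt_atTop 0] with x hx
    have : x ≤ Real.sqrt (1 + x ^ 2) := Real.le_sqrt_of_sq_le (by linarith)
    linarith
  · filter_upwards [eventually_gt_atTop 0] with x hx
    have : Real.sqrt (1 + x ^ 2) ≤ x + x⁻¹ := by
      apply Real.sqrt_le_iff.2
      refine ⟨by positivity, ?_⟩
      have h : x * x⁻¹ = 1 := mul_inv_cancel₀ hx.ne'
      nlinarith [sq_nonneg x⁻¹]
    linarith

lemma s_tendsto (c : ℝ) (hc : 1 < c) :
    Tendsto (fun r : ℝ => (lam c r - 1) * r) atTop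
      (nhds (1 / (c * Real.sqrt (c ^ 2 - 1)))) := by
  have hp : 0 < c ^ 2 - 1 := by nlinarith
  have hA : 0 < c ^ 4 - c ^ 2 := by nlinarith [mul_pos (pow_pos (by linarith : 0 < c) 2) hp]
  have e : Real.sqrt (c ^ 4 - c ^ 2) = c * Real.sqrt (c ^ 2 - 1) := by
    rw [show c ^ 4 - c ^ 2 = c ^ 2 * (c ^ 2 - 1) by ring, Real.sqrt_mul (by positivity),
      Real.sqrt_sq (by linarith)]
  have h1 : Tendsto (fun r : ℝ => 1 / Real.sqrt ((c ^ 4 - c ^ 2) + c ^ 4 * (r⁻¹) ^ 2)) atTop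
      (nhds (1 / Real.sqrt ((c ^ 4 - c ^ 2) + c ^ 4 * 0 ^ 2))) := by
    refine Tendsto.div tendsto_const_nhds ?_ ?_
    · exact (((tendsto_inv_atTop_zero.pow 2).const_mul _).const_add _).sqrt
    · apply (Real.sqrt_pos.2 _).ne'
      linarith
  rw [show (c ^ 4 - c ^ 2) + c ^ 4 * 0 ^ 2 = c ^ 4 - c ^ 2 by ring, e] at h1
  refine h1.congr' ?_
  filter_upwards [eventually_gt_atTop 0] with r hr
  have e2 : (c ^ 4 - c ^ 2) * r ^ 2 + c ^ 4
      = ((c ^ 4 - c ^ 2) + c ^ 4 * (r⁻¹) ^ 2) * r ^ 2 := by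
    field_simp
  have h3 : 0 < Real.sqrt ((c ^ 4 - c ^ 2) + c ^ 4 * (r⁻¹) ^ 2) :=
    Real.sqrt_pos.2 (by positivity)
  unfold lam
  rw [e2, Real.sqrt_mul (by positivity), Real.sqrt_sq hr.le, add_sub_cancel_left, one_div,
    one_div, mul_inv, mul_assoc, inv_mul_cancel₀ hr.ne', mul_one]

lemma main_tendsto (c : ℝ) (hc : 1 < c) :
    Tendsto (fun r : ℝ =>
        Real.sqrt (1 + (lam c r) ^ 2 * r ^ 2) - Real.sqrt (1 + r ^ 2)
          - Real.sqrt (1 + c ^ 2 * (lam c r - 1) ^ 2 * r ^ 2))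
      atTop (nhds (-Real.sqrt (c ^ 2 - 1) / c)) := by
  have hp : 0 < c ^ 2 - 1 := by nlinarith
  have hs := s_tendsto c hc
  have hx : Tendsto (fun r : ℝ => r + (lam c r - 1) * r) atTop atTop :=
    tendsto_id.atTop_add hs
  have h := ((hs.add (g_tendsto.comp hx)).sub g_tendsto).sub
    (((hs.pow 2).const_mul (c ^ 2)).const_add 1).sqrt
  have hq : 0 < Real.sqrt (c ^ 2 - 1) := Real.sqrt_pos.2 hp
  have hq2 : Real.sqrt (c ^ 2 - 1) ^ 2 = c ^ 2 - 1 := Real.sq_sqrt hp.le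
  have hc0 : 0 < c := by linarith
  have e : Real.sqrt (1 + c ^ 2 * (1 / (c * Real.sqrt (c ^ 2 - 1))) ^ 2)
      = c / Real.sqrt (c ^ 2 - 1) := by
    rw [Real.sqrt_eq_iff_mul_self_eq (by positivity) (by positivity)]
    generalize Real.sqrt (c ^ 2 - 1) = q at *
    field_simp
    linarith
  rw [e] at h
  have e2 : 1 / (c * Real.sqrt (c ^ 2 - 1)) + 0 - 0 - c / Real.sqrt (c ^ 2 - 1)
      = -Real.sqrt (c ^ 2 - 1) / c := by
    generalize Real.sqrt (c ^ 2 - 1) = q at *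
    field_simp
    linarith
  rw [e2] at h
  refine h.congr fun r => ?_
  simp only [Function.comp]
  rw [show 1 + (r + (lam c r - 1) * r) ^ 2 = 1 + (lam c r) ^ 2 * r ^ 2 by ring,
    show 1 + c ^ 2 * ((lam c r - 1) * r) ^ 2 = 1 + c ^ 2 * (lam c r - 1) ^ 2 * r ^ 2 by ring]
  ring

/-- Nonvanishing limit of the phase along the space-resonant set at
high frequencies: for `c > 1`,
`√(1+λ(r)²r²) − √(1+r²) − √(1+c²(λ(r)−1)²r²) → −√(c²−1)/c` as `r → ∞`;
in particular the phase stays bounded away from zero along this curve for all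
sufficiently large `r`. -/
theorem stmt19 (c : ℝ) (hc : 1 < c) :
    Tendsto (fun r : ℝ =>
        Real.sqrt (1 + (lam c r) ^ 2 * r ^ 2) - Real.sqrt (1 + r ^ 2)
          - Real.sqrt (1 + c ^ 2 * (lam c r - 1) ^ 2 * r ^ 2))
      atTop (nhds (-Real.sqrt (c ^ 2 - 1) / c)) ∧
    ∃ δ > (0 : ℝ), ∃ r₀ : ℝ, ∀ r ≥ r₀,
      δ ≤ |Real.sqrt (1 + (lam c r) ^ 2 * r ^ 2) - Real.sqrt (1 + r ^ 2)
            - Real.sqrt (1 + c ^ 2 * (lam c r - 1) ^ 2 * r ^ 2)| := by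
  refine ⟨main_tendsto c hc, ?_⟩
  have hq : 0 < Real.sqrt (c ^ 2 - 1) / c :=
    div_pos (Real.sqrt_pos.2 (by nlinarith)) (by linarith)
  have h := (main_tendsto c hc).abs
  rw [neg_div, abs_neg, abs_of_pos hq] at h
  obtain ⟨r₀, hr⟩ := eventually_atTop.1 (h.eventually_const_le (half_lt_self hq))
  exact ⟨_, half_pos hq, r₀, hr⟩
end
end
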